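/- arXiv:2006.11464 — 5 statements merged into one kernel-verified Lean document; each statement's English description precedes it below -/
import Mathlib

section
/- Let Λ be a set and let Γ be a subshift of Λ^ω. If Γ is a subshift of bounded type, then the system (Γ, σ) has the shadowing property with respect to the metric d(x,y) = inf{2^{-n} : x_i = y_i for all i < n}. -/
open Set Filter Topology

/-- The shift map `σ` on `ℕ → Λ`, defined by `σ(x)(n) = x(n+1)`. -/
def shift {Λ : Type*} (x : ℕ → Λ) : ℕ → Λ := fun n => x (n + 1)

/-- The Baire metric `d(x,y) = inf {2^{-n} : x_i = y_i for all i < n}`. -/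
noncomputable def bDist {Λ : Type*} (x y : ℕ → Λ) : ℝ :=
  sInf {r : ℝ | ∃ n : ℕ, r = (2 : ℝ)⁻¹ ^ n ∧ ∀ i < n, x i = y i}

/-- `Γ` is a subshift: a closed, shift-invariant subset of `ℕ → Λ`. -/
def IsSubshift {Λ : Type*} [TopologicalSpace Λ] (Γ : Set (ℕ → Λ)) : Prop :=
  IsClosed Γ ∧ shift '' Γ = Γ

/-- The finite word `w` is allowed in `Γ`: it occurs as a consecutive block in some point of `Γ`. -/
def Allowed {Λ : Type*} (Γ : Set (ℕ → Λ)) (w : List Λ) : Prop :=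
  ∃ x ∈ Γ, ∃ i : ℕ, ∀ (j : ℕ) (h : j < w.length), x (i + j) = w.get ⟨j, h⟩

/-- `F` is a basis for the forbidden words of `Γ`: each member of `F` is forbidden, and every
forbidden word contains a member of `F` as a consecutive (infix) subword. -/
def IsForbiddenBasis {Λ : Type*} (Γ : Set (ℕ → Λ)) (F : Set (List Λ)) : Prop :=
  (∀ w ∈ F, ¬ Allowed Γ w) ∧ ∀ w : List Λ, ¬ Allowed Γ w → ∃ v ∈ F, v <:+: w

/-- `Γ` is a subshift of finite type: it has a finite basis for its forbidden words. -/
def IsSFT {Λ : Type*} (Γ : Set (ℕ → Λ)) : Prop :=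
  ∃ F : Set (List Λ), F.Finite ∧ IsForbiddenBasis Γ F

/-- `Γ` is a subshift of bounded type: it has a basis for its forbidden words whose members
have uniformly bounded length. -/
def IsSBT {Λ : Type*} (Γ : Set (ℕ → Λ)) : Prop :=
  ∃ F : Set (List Λ), (∃ N : ℕ, ∀ w ∈ F, w.length ≤ N) ∧ IsForbiddenBasis Γ F

/-- `(Γ, σ)` has the shadowing property w.r.t. the Baire metric. -/
def HasShadowing {Λ : Type*} (Γ : Set (ℕ → Λ)) : Prop :=
  ∀ ε : ℝ, 0 < ε → ∃ δ : ℝ, 0 < δ ∧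
    ∀ x : ℕ → (ℕ → Λ), (∀ i, x i ∈ Γ) →
      (∀ i, bDist (shift (x i)) (x (i + 1)) < δ) →
      ∃ z ∈ Γ, ∀ i, bDist (shift^[i] z) (x i) < ε

theorem bDist_le_of_agree {Λ : Type*} {x y : ℕ → Λ} {n : ℕ} (h : ∀ i < n, x i = y i) :
    bDist x y ≤ (2 : ℝ)⁻¹ ^ n := by
  refine csInf_le ⟨0, ?_⟩ ⟨n, rfl, h⟩
  rintro r ⟨k, rfl, -⟩
  positivity

theorem agree_of_bDist_lt {Λ : Type*} {x y : ℕ → Λ} {n : ℕ} (h : bDist x y < (2 : ℝ)⁻¹ ^ n) :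
    ∀ i < n, x i = y i := by
  have hne : {r : ℝ | ∃ k : ℕ, r = (2 : ℝ)⁻¹ ^ k ∧ ∀ i < k, x i = y i}.Nonempty :=
    ⟨1, 0, by simp⟩
  obtain ⟨r, ⟨k, rfl, hk⟩, hr⟩ := exists_lt_of_csInf_lt hne h
  have hnk : n < k := (pow_lt_pow_iff_right_of_lt_one₀ (by norm_num) (by norm_num)).1 hr
  exact fun i hi => hk i (hi.trans hnk)

theorem shift_iterate_apply {Λ : Type*} (x : ℕ → Λ) (i n : ℕ) :
    shift^[i] x n = x (i + n) := by
  induction i generalizing x with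
  | zero => simp
  | succ i ih =>
    rw [Function.iterate_succ_apply, ih]
    exact congrArg x (by omega)

theorem IsSubshift.shift_iterate_mem {Λ : Type*} [TopologicalSpace Λ] {Γ : Set (ℕ → Λ)}
    (hΓ : IsSubshift Γ) {x : ℕ → Λ} (hx : x ∈ Γ) (i : ℕ) : shift^[i] x ∈ Γ := by
  induction i with
  | zero => exact hx
  | succ i ih =>
    rw [Function.iterate_succ_apply', ← hΓ.2]
    exact mem_image_of_mem shift ih

/-- A sequence all of whose prefixes are allowed in a subshift belongs to it. -/
theorem IsSubshift.mem_of_allowed_prefixes {Λ : Type*} [TopologicalSpace Λ] {Γ : Set (ℕ → Λ)}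
    (hΓ : IsSubshift Γ) {z : ℕ → Λ} (h : ∀ n, Allowed Γ ((List.range n).map z)) : z ∈ Γ := by
  choose y hy i hi using h
  refine hΓ.1.mem_of_tendsto (b := atTop) (f := fun n => shift^[i n] (y n)) ?_
    (Eventually.of_forall fun n => hΓ.shift_iterate_mem (hy n) (i n))
  refine tendsto_pi_nhds.2 fun k => tendsto_const_nhds.congr' ?_
  filter_upwards [eventually_gt_atTop k] with n hn
  rw [shift_iterate_apply, hi n k (by simpa using hn)]
  simp

/-- If every block of `z` of length `N` occurs in `Γ`, and the forbidden words of `Γ` have a basis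
of words of length at most `N`, then `z` belongs to `Γ`. -/
theorem IsSubshift.mem_of_blocks {Λ : Type*} [TopologicalSpace Λ] {Γ : Set (ℕ → Λ)}
    (hΓ : IsSubshift Γ) {F : Set (List Λ)} {N : ℕ} (hN : ∀ w ∈ F, w.length ≤ N)
    (hF : IsForbiddenBasis Γ F) {z : ℕ → Λ}
    (h : ∀ i, ∃ x ∈ Γ, ∀ j < N, x j = z (i + j)) : z ∈ Γ := by
  refine hΓ.mem_of_allowed_prefixes fun n => ?_
  by_contra hn
  obtain ⟨v, hv, s, t, hst⟩ := hF.2 _ hn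
  obtain ⟨x, hx, hxz⟩ := h s.length
  refine hF.1 v hv ⟨x, hx, 0, fun j hj => ?_⟩
  have hlen := congrArg List.length hst
  simp only [List.length_append, List.length_map, List.length_range] at hlen
  have hget : (s ++ v ++ t)[s.length + j]? = ((List.range n).map z)[s.length + j]? := by rw [hst]
  have hjn : s.length + j < n := by omega
  rw [List.append_assoc, List.getElem?_append_right (by omega), Nat.add_sub_cancel_left,
    List.getElem?_append_left hj, List.getElem?_eq_getElem hj] at hget
  simp [hjn] at hget
  rw [zero_add, hxz j (hj.trans_le (hN v hv)), ← hget, List.get_eq_getElem]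

/-- A subshift of bounded type has the shadowing property. -/
theorem sbt_hasShadowing {Λ : Type*} [TopologicalSpace Λ] [DiscreteTopology Λ]
    (Γ : Set (ℕ → Λ)) (hΓ : IsSubshift Γ) (hSBT : IsSBT Γ) :
    HasShadowing Γ := by
  obtain ⟨F, ⟨N, hN⟩, hF⟩ := hSBT
  intro ε hε
  obtain ⟨m, hm⟩ := exists_pow_lt_of_lt_one hε (by norm_num : (2 : ℝ)⁻¹ < 1)
  refine ⟨(2 : ℝ)⁻¹ ^ max N m, by positivity, fun x hx hpseudo => ?_⟩
  have hdiag : ∀ j < max N m, ∀ i, x i j = x (i + j) 0 := by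
    intro j
    induction j with
    | zero => simp
    | succ j ih =>
      intro hj i
      have hstep : x i (j + 1) = x (i + 1) j := agree_of_bDist_lt (hpseudo i) j (by omega)
      rw [hstep, ih (by omega), add_right_comm, add_assoc]
  refine ⟨fun n => x n 0, hΓ.mem_of_blocks hN hF fun i =>
    ⟨x i, hx i, fun j hj => hdiag j (hj.trans_le (le_max_left N m)) i⟩, fun i => ?_⟩
  refine (bDist_le_of_agree fun j hj => ?_).trans_lt hm
  rw [shift_iterate_apply, hdiag j (hj.trans_le (le_max_right N m)) i]
end

section
/- Let (X, d) be a metric space and f : X → X a surjective map. If (X, f) is positively expansive with some expansive constant c > 0 and has the shadowing property, then (X, f) has the asymptotic shadowing property. -/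
open Set Filter Topology

/-- A positively expansive surjective system with shadowing has asymptotic shadowing:
for every asymptotic pseudo-orbit `(x_i)` there is a point `z` whose orbit asymptotically
shadows `(x_i)`. -/
theorem posExpansive_shadowing_asymptoticShadowing {X : Type*} [MetricSpace X]
    (f : X → X) (hsurj : Function.Surjective f) (c : ℝ) (hc : 0 < c)
    (hexp : ∀ x y : X, (∀ n : ℕ, dist (f^[n] x) (f^[n] y) < c) → x = y)
    (hshad : ∀ ε : ℝ, 0 < ε → ∃ δ : ℝ, 0 < δ ∧ ∀ x : ℕ → X,
      (∀ i, dist (f (x i)) (x (i + 1)) < δ) → ∃ z : X, ∀ i, dist (f^[i] z) (x i) < ε) :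
    ∀ x : ℕ → X, Tendsto (fun i => dist (f (x i)) (x (i + 1))) atTop (𝓝 0) →
      ∃ z : X, Tendsto (fun i => dist (f^[i] z) (x i)) atTop (𝓝 0) := by
  intro x hx
  have tail_shadow : ∀ ε : ℝ, 0 < ε → ∃ N : ℕ, ∀ M, N ≤ M →
      ∃ z : X, ∀ i, dist (f^[i] z) (x (M + i)) < ε := by
    intro ε hε
    obtain ⟨δ, hδ, hδε⟩ := hshad ε hε
    obtain ⟨N, hN⟩ := eventually_atTop.1 (hx.eventually (gt_mem_nhds hδ))
    exact ⟨N, fun M hM => hδε (fun i => x (M + i)) fun i => hN (M + i) (by omega)⟩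
  obtain ⟨N₀, hN₀⟩ := tail_shadow (c / 2) (half_pos hc)
  obtain ⟨w, hw⟩ := hN₀ N₀ le_rfl
  obtain ⟨z, rfl⟩ := hsurj.iterate N₀ w
  refine ⟨z, Metric.tendsto_atTop.2 fun ε hε => ?_⟩
  obtain ⟨N, hN⟩ := tail_shadow (min ε (c / 2)) (lt_min hε (half_pos hc))
  obtain ⟨y, hy⟩ := hN (N₀ + N) (by omega)
  have hzy : f^[N₀ + N] z = y := by
    refine hexp _ _ fun i => ?_
    have h₁ := hw (N + i)
    rw [← Function.iterate_add_apply, show N + i + N₀ = i + (N₀ + N) by omega,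
      Function.iterate_add_apply, ← add_assoc] at h₁
    have h₂ := (hy i).trans_le (min_le_right _ _)
    linarith [dist_triangle_right (f^[i] (f^[N₀ + N] z)) (f^[i] y) (x (N₀ + N + i))]
  refine ⟨N₀ + N, fun n hn => ?_⟩
  obtain ⟨i, rfl⟩ := Nat.exists_eq_add_of_le hn
  rw [Real.dist_0_eq_abs, abs_of_nonneg dist_nonneg, add_comm _ i,
    Function.iterate_add_apply, hzy, add_comm i]
  exact (hy i).trans_le (min_le_left _ _)
end

section
/- Let X be a separable metric space, f : X → X a continuous map, and Z ⊆ X a nonempty closed internally chain transitive set. Then there exists a sequence (x_i) of points of Z which is an asymptotic pseudo-orbit for f and whose ω-limit set ω((x_i)) equals Z. -/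
open Set Filter Topology

/-- The ω-limit set of a sequence: `⋂_N cl {u i : i ≥ N}`. -/
def omegaSeq {X : Type*} [TopologicalSpace X] (u : ℕ → X) : Set X :=
  ⋂ N : ℕ, closure (u '' Set.Ici N)

/-- `A` is internally chain transitive for `f`: for all `a, b ∈ A` and `δ > 0` there is a
`δ`-chain from `a` to `b` consisting of elements of `A`. -/
def IsICTFor {X : Type*} [MetricSpace X] (f : X → X) (A : Set X) : Prop :=
  ∀ a ∈ A, ∀ b ∈ A, ∀ δ : ℝ, 0 < δ → ∃ n : ℕ, 1 ≤ n ∧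
    ∃ cc : ℕ → X, cc 0 = a ∧ cc n = b ∧ (∀ i ≤ n, cc i ∈ A) ∧
      ∀ i < n, dist (f (cc i)) (cc (i + 1)) < δ

/-- Successive positions `(k, j)` (the `j`-th point of the `k`-th block) when reading blocks of
lengths `n 0, n 1, …` one after another. -/
def blockPosition (n : ℕ → ℕ) : ℕ → ℕ × ℕ
  | 0 => (0, 0)
  | i + 1 =>
    if (blockPosition n i).2 + 1 < n (blockPosition n i).1 then
      ((blockPosition n i).1, (blockPosition n i).2 + 1)
    else ((blockPosition n i).1 + 1, 0)

theorem blockPosition_snd_lt {n : ℕ → ℕ} (hn : ∀ k, 1 ≤ n k) (i : ℕ) :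
    (blockPosition n i).2 < n (blockPosition n i).1 := by
  induction i with
  | zero => exact hn 0
  | succ i ih =>
    rw [blockPosition]
    split_ifs with h
    · exact h
    · exact hn _

theorem blockPosition_fst_le (n : ℕ → ℕ) (i : ℕ) : (blockPosition n i).1 ≤ i := by
  induction i with
  | zero => exact le_rfl
  | succ i ih =>
    rw [blockPosition]
    split_ifs <;> dsimp only <;> omega

theorem blockPosition_fst_monotone (n : ℕ → ℕ) : Monotone fun i => (blockPosition n i).1 := by
  refine monotone_nat_of_le_succ fun i => ?_
  rw [blockPosition]
  split_ifs <;> dsimp only <;> omega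

theorem blockPosition_add {n : ℕ → ℕ} {i k : ℕ} (hi : blockPosition n i = (k, 0)) (j : ℕ)
    (hj : j < n k) : blockPosition n (i + j) = (k, j) := by
  induction j with
  | zero => exact hi
  | succ j ih =>
    rw [← add_assoc, blockPosition, ih (by omega)]
    exact if_pos hj

theorem exists_blockPosition_eq {n : ℕ → ℕ} (hn : ∀ k, 1 ≤ n k) (k : ℕ) :
    ∃ i, blockPosition n i = (k, 0) := by
  induction k with
  | zero => exact ⟨0, rfl⟩
  | succ k ih =>
    obtain ⟨i, hi⟩ := ih
    have hk := hn k
    refine ⟨i + (n k - 1) + 1, ?_⟩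
    rw [blockPosition, blockPosition_add hi _ (by omega)]
    exact if_neg (by dsimp only; omega)

theorem tendsto_blockPosition_fst {n : ℕ → ℕ} (hn : ∀ k, 1 ≤ n k) :
    Tendsto (fun i => (blockPosition n i).1) atTop atTop := by
  refine tendsto_atTop_atTop_of_monotone (blockPosition_fst_monotone n) fun k => ?_
  obtain ⟨i, hi⟩ := exists_blockPosition_eq hn k
  exact ⟨i, by rw [hi]⟩

/-- In a separable metric space, a nonempty closed internally chain transitive set `Z` is
the ω-limit set of some asymptotic pseudo-orbit consisting of points of `Z`. -/
theorem ict_asymptoticPseudoOrbit {X : Type*} [MetricSpace X]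
    [TopologicalSpace.SeparableSpace X] (f : X → X) (hf : Continuous f)
    (Z : Set X) (hne : Z.Nonempty) (hcl : IsClosed Z) (hict : IsICTFor f Z) :
    ∃ x : ℕ → X, (∀ i, x i ∈ Z) ∧
      Tendsto (fun i => dist (f (x i)) (x (i + 1))) atTop (𝓝 0) ∧
      omegaSeq x = Z := by
  have : Nonempty Z := hne.to_subtype
  let e : ℕ → Z := fun k => TopologicalSpace.denseSeq Z k.unpair.1
  have hchain (k : ℕ) := hict (e k) (e k).2 (e (k + 1)) (e (k + 1)).2 (1 / ((k : ℝ) + 1))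
    Nat.one_div_pos_of_nat
  choose n hn c hc0 hcn hcZ hcd using hchain
  let x : ℕ → X := fun i => c (blockPosition n i).1 (blockPosition n i).2
  have hxZ (i : ℕ) : x i ∈ Z := hcZ _ _ (blockPosition_snd_lt hn i).le
  refine ⟨x, hxZ, ?_, Subset.antisymm ?_ ?_⟩
  · refine squeeze_zero (fun _ => dist_nonneg) (fun i => ?_)
      (tendsto_one_div_add_atTop_nhds_zero_nat.comp (tendsto_blockPosition_fst hn))
    have hlt := blockPosition_snd_lt hn i
    have hnext : x (i + 1) = c (blockPosition n i).1 ((blockPosition n i).2 + 1) := by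
      dsimp only [x]
      rw [blockPosition]
      split_ifs with h
      · rfl
      · rw [show (blockPosition n i).2 + 1 = n (blockPosition n i).1 by omega, hcn]
        exact hc0 _
    rw [hnext]
    exact (hcd _ _ hlt).le
  · refine (iInter_subset _ 0).trans (closure_minimal ?_ hcl)
    rintro _ ⟨i, -, rfl⟩
    exact hxZ i
  · refine subset_iInter fun N => ?_
    have hdense : Z ⊆ closure (Subtype.val '' range (TopologicalSpace.denseSeq Z)) := fun z hz =>
      image_closure_subset_closure_image continuous_subtype_val
        ⟨⟨z, hz⟩, TopologicalSpace.denseRange_denseSeq Z _, rfl⟩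
    refine hdense.trans (closure_mono ?_)
    rintro _ ⟨_, ⟨m, rfl⟩, rfl⟩
    obtain ⟨i, hi⟩ := exists_blockPosition_eq hn (Nat.pair m N)
    refine ⟨i, ?_, ?_⟩
    · have hle := blockPosition_fst_le n i
      rw [hi] at hle
      exact (Nat.right_le_pair m N).trans hle
    · dsimp only [x]
      rw [hi, hc0]
      simp [e]
end

section
/- Let Γ = {x ∈ ℕ^ω : x_n ≤ x_{n+1} for all n ∈ ℕ} be the set of nondecreasing sequences in the full shift (ℕ^ω, σ). Then Γ is a subshift of bounded type (with basis of forbidden words {st : s, t ∈ ℕ, s > t}), but Γ is not internally chain transitive. -/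
open Set Filter Topology

/-- `A` is internally chain transitive for the shift (w.r.t. the Baire metric): for all
`a, b ∈ A` and `δ > 0` there is a `δ`-chain from `a` to `b` consisting of elements of `A`. -/
def IsICT {Λ : Type*} (A : Set (ℕ → Λ)) : Prop :=
  ∀ a ∈ A, ∀ b ∈ A, ∀ δ : ℝ, 0 < δ → ∃ n : ℕ, 1 ≤ n ∧
    ∃ c : ℕ → (ℕ → Λ), c 0 = a ∧ c n = b ∧ (∀ i ≤ n, c i ∈ A) ∧
      ∀ i < n, bDist (shift (c i)) (c (i + 1)) < δ

theorem apply_zero_eq_of_bDist_lt_one {Λ : Type*} {x y : ℕ → Λ} (h : bDist x y < 1) :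
    x 0 = y 0 := by
  have hne : {r : ℝ | ∃ n : ℕ, r = (2 : ℝ)⁻¹ ^ n ∧ ∀ i < n, x i = y i}.Nonempty :=
    ⟨1, 0, by simp⟩
  obtain ⟨r, ⟨n, rfl, hn⟩, hr⟩ := exists_lt_of_csInf_lt hne h
  rcases Nat.eq_zero_or_pos n with rfl | hpos
  · simp at hr
  · exact hn 0 hpos

theorem isClosed_setOf_le_succ : IsClosed {x : ℕ → ℕ | ∀ n : ℕ, x n ≤ x (n + 1)} := by
  simp only [ofPred_forall]
  exact isClosed_iInter fun n => isClosed_le (continuous_apply n) (continuous_apply (n + 1))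

theorem shift_image_setOf_le_succ :
    shift '' {x : ℕ → ℕ | ∀ n : ℕ, x n ≤ x (n + 1)} = {x : ℕ → ℕ | ∀ n : ℕ, x n ≤ x (n + 1)} := by
  ext y
  constructor
  · rintro ⟨x, hx, rfl⟩ n
    exact hx (n + 1)
  · intro hy
    refine ⟨fun n => y (n - 1), fun n => ?_, rfl⟩
    rcases n with _ | n
    · exact le_rfl
    · exact hy n

theorem pair_infix_of_succ_lt_length {α : Type*} (w : List α) (n : ℕ) (h : n + 1 < w.length) :
    [w[n], w[n + 1]] <:+: w := by
  refine ⟨w.take n, w.drop (n + 2), ?_⟩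
  conv_rhs => rw [← List.take_append_drop n w, List.drop_eq_getElem_cons (by omega : n < w.length),
    List.drop_eq_getElem_cons h]
  simp

theorem isForbiddenBasis_descents :
    IsForbiddenBasis {x : ℕ → ℕ | ∀ n : ℕ, x n ≤ x (n + 1)}
      {w : List ℕ | ∃ s t : ℕ, t < s ∧ w = [s, t]} := by
  constructor
  · rintro _ ⟨s, t, hts, rfl⟩ ⟨x, hx, i, h⟩
    have h0 : x i = s := h 0 (by simp)
    have h1 : x (i + 1) = t := h 1 (by simp)
    have := hx i
    omega
  · intro w hw
    by_contra! hF
    refine hw ⟨fun n => w.getD (min n (w.length - 1)) 0, fun n => ?_, 0, fun j hj => ?_⟩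
    · beta_reduce
      by_cases hn : n + 1 < w.length
      · have hle : w[n] ≤ w[n + 1] := not_lt.mp fun hlt =>
          hF _ ⟨_, _, hlt, rfl⟩ (pair_infix_of_succ_lt_length w n hn)
        rw [min_eq_left (by omega : n ≤ w.length - 1),
          min_eq_left (by omega : n + 1 ≤ w.length - 1),
          List.getD_eq_getElem _ _ (by omega : n < w.length), List.getD_eq_getElem _ _ hn]
        exact hle
      · rw [min_eq_right (by omega : w.length - 1 ≤ n),
          min_eq_right (by omega : w.length - 1 ≤ n + 1)]
    · beta_reduce
      rw [zero_add, min_eq_left (by omega : j ≤ w.length - 1), List.getD_eq_getElem _ _ hj]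
      rfl

theorem not_isICT_setOf_le_succ : ¬ IsICT {x : ℕ → ℕ | ∀ n : ℕ, x n ≤ x (n + 1)} := by
  intro h
  obtain ⟨n, -, c, h0, hn, hc, hd⟩ :=
    h (fun _ => 1) (fun _ => le_rfl) (fun _ => 0) (fun _ => le_rfl) 1 one_pos
  have key : ∀ i ≤ n, 1 ≤ c i 0 := by
    intro i
    induction i with
    | zero => simp [h0]
    | succ i ih =>
      intro hi
      rw [← apply_zero_eq_of_bDist_lt_one (hd i hi)]
      exact (ih (by omega)).trans (hc i (by omega) 0)
  simpa [hn] using key n le_rfl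

/-- The set of nondecreasing sequences in `ℕ^ω` is a subshift of bounded type, with basis of
forbidden words `{st : s > t}`, but it is not internally chain transitive. -/
theorem monotone_subshift_sbt_not_ict :
    IsSubshift {x : ℕ → ℕ | ∀ n : ℕ, x n ≤ x (n + 1)} ∧
    IsForbiddenBasis {x : ℕ → ℕ | ∀ n : ℕ, x n ≤ x (n + 1)}
      {w : List ℕ | ∃ s t : ℕ, t < s ∧ w = [s, t]} ∧
    IsSBT {x : ℕ → ℕ | ∀ n : ℕ, x n ≤ x (n + 1)} ∧
    ¬ IsICT {x : ℕ → ℕ | ∀ n : ℕ, x n ≤ x (n + 1)} := by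
  refine ⟨⟨isClosed_setOf_le_succ, shift_image_setOf_le_succ⟩, isForbiddenBasis_descents,
    ⟨_, ⟨2, ?_⟩, isForbiddenBasis_descents⟩, not_isICT_setOf_le_succ⟩
  rintro _ ⟨s, t, -, rfl⟩
  simp
end

section
/- In the full shift (ℕ^ω, σ) over the countable alphabet ℕ, there exists a point x ∈ ℕ^ω such that ω(x) = {0̄} ∪ {0^k 1̄ : k ∈ ℕ}, where 0̄ is the constant-0 sequence and 0^k 1̄ is the sequence consisting of k zeros followed by constant 1s (so k = 0 gives the constant-1 sequence); this set is closed and σ-invariant, but it is not a union of closed internally chain transitive sets: for every k ≥ 1, no internally chain transitive subset of ω(x) contains the point 0^k 1̄. -/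
open Set Filter Topology

/-- The ω-limit set of a point under the shift map. -/
def omegaPt {Λ : Type*} [TopologicalSpace Λ] (x : ℕ → Λ) : Set (ℕ → Λ) :=
  omegaSeq fun i => shift^[i] x

/-- The point `0^k 1̄` of `ℕ^ω`: `k` zeros followed by constant ones. -/
def zeroPowOnes (k : ℕ) : ℕ → ℕ := fun i => if i < k then 0 else 1

lemma mem_omegaPt_iff {Λ : Type*} [TopologicalSpace Λ] [DiscreteTopology Λ] {x y : ℕ → Λ} :
    y ∈ omegaPt x ↔ ∀ N L : ℕ, ∃ m, N ≤ m ∧ ∀ i < L, x (m + i) = y i := by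
  have iter : ∀ m i : ℕ, (shift^[m] x) i = x (m + i) := by
    intro m
    induction m with
    | zero => simp
    | succ m ih =>
      intro i
      rw [Function.iterate_succ_apply']
      change (shift^[m] x) (i + 1) = _
      rw [ih]
      congr 1
      omega
  simp only [omegaPt, omegaSeq, mem_iInter]
  refine forall_congr' fun N => ?_
  rw [mem_closure_iff_nhds]
  constructor
  · intro h L
    have hU : {z : ℕ → Λ | ∀ i ∈ Finset.range L, z i = y i} ∈ 𝓝 y := by
      have : ∀ᶠ z in 𝓝 y, ∀ i ∈ Finset.range L, z i = y i := by
        rw [Filter.eventually_all_finset]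
        intro i _
        exact (continuous_apply i).continuousAt.eventually
          ((isOpen_discrete {y i}).mem_nhds rfl)
      exact this
    obtain ⟨_, hz, m, hm, rfl⟩ := h _ hU
    exact ⟨m, hm, fun i hi => by rw [← iter]; exact hz i (Finset.mem_range.2 hi)⟩
  · intro h U hU
    rw [nhds_pi, Filter.mem_pi] at hU
    obtain ⟨I, hI, t, ht, hsub⟩ := hU
    obtain ⟨B, hB⟩ := hI.bddAbove
    obtain ⟨m, hm, hx⟩ := h (B + 1)
    refine ⟨shift^[m] x, hsub fun i hi => ?_, m, hm, rfl⟩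
    rw [iter, hx i (Nat.lt_succ_of_le (hB hi))]
    exact mem_of_mem_nhds (ht i)

/-- Agreement of initial segments for points at Baire distance less than `2⁻¹ ^ k`. -/
lemma eq_of_bDist_lt {Λ : Type*} {x y : ℕ → Λ} {k : ℕ} (h : bDist x y < (2 : ℝ)⁻¹ ^ k) :
    ∀ i ≤ k, x i = y i := by
  obtain ⟨_, ⟨n, rfl, hn⟩, hlt⟩ := exists_lt_of_csInf_lt
    (s := {r : ℝ | ∃ n : ℕ, r = (2 : ℝ)⁻¹ ^ n ∧ ∀ i < n, x i = y i}) ⟨1, 0, by simp⟩ h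
  have hk : k < n := (pow_lt_pow_iff_right_of_lt_one₀ (by norm_num) (by norm_num)).1 hlt
  exact fun i hi => hn i (hi.trans_lt hk)

lemma zero_or_zeroPowOnes_iff :
    ({fun _ => 0} ∪ {y : ℕ → ℕ | ∃ k : ℕ, y = zeroPowOnes k}) =
      {y : ℕ → ℕ | ∀ i, y i ≤ y (i + 1) ∧ y i ≤ 1} := by
  ext y
  simp only [mem_union, mem_singleton_iff, mem_ofPred_eq]
  constructor
  · rintro (rfl | ⟨k, rfl⟩) i
    · simp
    · simp only [zeroPowOnes]
      grind
  · intro h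
    by_cases h0 : ∃ k, y k ≠ 0
    · refine Or.inr ⟨Nat.find h0, funext fun i => ?_⟩
      have hmono : Monotone y := monotone_nat_of_le_succ fun i => (h i).1
      unfold zeroPowOnes
      split_ifs with hi
      · simpa using Nat.find_min h0 hi
      · have := hmono (not_lt.1 hi)
        have := Nat.find_spec h0
        have := (h i).2
        omega
    · push Not at h0
      exact Or.inl (funext h0)

/-- The concatenation over `s` of the words `0^s 1^s (s+2)`, the `s`-th one occupying the
positions from `s ^ 2` to `(s + 1) ^ 2 - 1`. -/
def blockPoint (n : ℕ) : ℕ :=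
  if n - n.sqrt * n.sqrt < n.sqrt then 0
  else if n - n.sqrt * n.sqrt < n.sqrt + n.sqrt then 1 else n.sqrt + 2

lemma blockPoint_add {s r : ℕ} (h : r ≤ s + s) :
    blockPoint (s * s + r) = if r < s then 0 else if r < s + s then 1 else s + 2 := by
  simp [blockPoint, Nat.sqrt_add_eq s h]

lemma blockPoint_le_succ {n : ℕ} (h : blockPoint n ≤ 1) :
    blockPoint n ≤ blockPoint (n + 1) := by
  obtain ⟨r, hr⟩ := Nat.exists_eq_add_of_le (Nat.sqrt_le n)
  have hle := Nat.sqrt_le_add n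
  generalize n.sqrt = s at *
  subst hr
  have hrs : r ≤ s + s := by omega
  rw [blockPoint_add hrs] at h ⊢
  have hlt : r + 1 ≤ s + s := by
    by_contra hc
    grind
  rw [add_assoc, blockPoint_add hlt]
  grind

lemma blockPoint_le_one_or {a n : ℕ} (h : a * a ≤ n) :
    blockPoint n ≤ 1 ∨ a + 2 ≤ blockPoint n := by
  have := Nat.le_sqrt.2 h
  unfold blockPoint
  grind

lemma omegaPt_blockPoint :
    omegaPt blockPoint = ({fun _ => 0} ∪ {y : ℕ → ℕ | ∃ k : ℕ, y = zeroPowOnes k}) := by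
  apply Subset.antisymm
  · rw [zero_or_zeroPowOnes_iff]
    intro y hy i
    rw [mem_omegaPt_iff] at hy
    obtain ⟨m, hm, hx⟩ := hy (y i * y i) (i + 2)
    have h0 := hx i (by omega)
    have h1 := hx (i + 1) (by omega)
    have hle : blockPoint (m + i) ≤ 1 := by
      rcases blockPoint_le_one_or (hm.trans (Nat.le_add_right m i)) with h | h <;> omega
    have := blockPoint_le_succ hle
    rw [add_assoc, h0, h1] at this
    exact ⟨this, h0 ▸ hle⟩
  · rintro y (hy | ⟨k, rfl⟩) <;> rw [mem_omegaPt_iff] <;> intro N L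
    · rw [mem_singleton_iff] at hy
      subst hy
      have := Nat.le_mul_self (N + L)
      refine ⟨(N + L) * (N + L), by omega, fun i hi => ?_⟩
      rw [blockPoint_add (by omega), if_pos (by omega)]
    · have := Nat.le_mul_self (N + L + k)
      refine ⟨(N + L + k) * (N + L + k) + (N + L), by omega, fun i hi => ?_⟩
      rw [add_assoc, blockPoint_add (by omega)]
      unfold zeroPowOnes
      grind

/-- In the full shift over `ℕ`, there is a point `x` with
`ω(x) = {0̄} ∪ {0^k 1̄ : k ∈ ℕ}`; this set is closed and `σ`-invariant, but it is not a
union of closed internally chain transitive sets: for every `k ≥ 1`, no internally chain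
transitive subset of `ω(x)` contains the point `0^k 1̄`. -/
theorem omega_not_union_of_ict :
    ∃ x : ℕ → ℕ,
      omegaPt x = ({fun _ => 0} ∪ {y : ℕ → ℕ | ∃ k : ℕ, y = zeroPowOnes k}) ∧
      IsClosed ({fun _ => 0} ∪ {y : ℕ → ℕ | ∃ k : ℕ, y = zeroPowOnes k}) ∧
      shift '' ({fun _ => 0} ∪ {y : ℕ → ℕ | ∃ k : ℕ, y = zeroPowOnes k}) =
        ({fun _ => 0} ∪ {y : ℕ → ℕ | ∃ k : ℕ, y = zeroPowOnes k}) ∧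
      ∀ k : ℕ, 1 ≤ k →
        ∀ A ⊆ ({fun _ => 0} ∪ {y : ℕ → ℕ | ∃ k : ℕ, y = zeroPowOnes k}),
          IsICT A → zeroPowOnes k ∉ A := by
  refine ⟨blockPoint, omegaPt_blockPoint, ?_⟩
  rw [zero_or_zeroPowOnes_iff]
  refine ⟨?_, ?_, ?_⟩
  · simp only [ofPred_forall]
    refine isClosed_iInter fun i => ?_
    exact (isClosed_le (continuous_apply i) (continuous_apply (i + 1))).inter
      (isClosed_le (continuous_apply i) continuous_const)
  · ext y
    constructor
    · rintro ⟨z, hz, rfl⟩ i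
      exact hz (i + 1)
    · intro hy
      refine ⟨fun i => i.casesOn 0 y, fun i => ?_, rfl⟩
      cases i with
      | zero => simp
      | succ i => exact hy i
  · intro k hk A hA hict hmem
    obtain ⟨k, rfl⟩ := Nat.exists_eq_add_of_le' hk
    obtain ⟨n, hn, c, hc0, hcn, hcA, hc⟩ := hict _ hmem _ hmem ((2 : ℝ)⁻¹ ^ k) (by positivity)
    have step : ∀ i < n, c (i + 1) k = c i (k + 1) := fun i hi =>
      (eq_of_bDist_lt (hc i hi) k le_rfl).symm
    have key : ∀ i < n, c (i + 1) k = 1 := by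
      intro i
      induction i with
      | zero =>
        intro hi
        rw [step 0 hi, hc0]
        simp [zeroPowOnes]
      | succ i ih =>
        intro hi
        have hprev := ih (by omega)
        have hle := (hA (hcA (i + 1) hi.le) k).1
        have hone := (hA (hcA (i + 1) hi.le) (k + 1)).2
        rw [step _ hi]
        omega
    have hlast := key (n - 1) (by omega)
    rw [Nat.sub_add_cancel hn, hcn] at hlast
    simp [zeroPowOnes] at hlast
end
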